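/- The unital ℝ-subalgebra Algebra.adjoin ℝ {P, D, K} of E generated by the operators P, D and K is isomorphic, as an ℝ-algebra, to the universal enveloping algebra of the real Lie algebra sl(2,ℝ) of traceless 2×2 real matrices, i.e., there exists an ℝ-algebra isomorphism Algebra.adjoin ℝ {P,D,K} ≃ₐ[ℝ] UniversalEnvelopingAlgebra ℝ (LieAlgebra.SpecialLinear.sl (Fin 2) ℝ). -/

import Mathlib

open MvPolynomial

/-- The algebra of `ℝ`-linear endomorphisms of the real polynomial ring in two
variables `x := X 0`, `y := X 1`. -/
noncomputable abbrev E : Type := Module.End ℝ (MvPolynomial (Fin 2) ℝ)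

/-- The partial derivative `∂_x` as a linear endomorphism. -/
noncomputable def Dx : E := (pderiv (0 : Fin 2)).toLinearMap

/-- The partial derivative `∂_y` as a linear endomorphism. -/
noncomputable def Dy : E := (pderiv (1 : Fin 2)).toLinearMap

/-- Multiplication by the polynomial `q` as a linear endomorphism. -/
noncomputable def M (q : MvPolynomial (Fin 2) ℝ) : E := LinearMap.mulLeft ℝ q

/-- The Lie-symmetry operator `P = ∂_y`. -/
noncomputable def P : E := Dy

/-- The Lie-symmetry operator `D = x ∂_x + y ∂_y`. -/
noncomputable def D : E := M (X 0) * Dx + M (X 1) * Dy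

/-- The Lie-symmetry operator `K = 2xy ∂_x + y² ∂_y + x`. -/
noncomputable def K : E := M (2 * X 0 * X 1) * Dx + M (X 1 ^ 2) * Dy + M (X 0)

section Sl2Relations

variable {A : Type*} [Ring A] [Algebra ℝ A] {p d k : A}

/-- The span of the ordered monomials `kⁱ dʲ pˡ`. -/
def orderedSpan (p d k : A) : Submodule ℝ A :=
  Submodule.span ℝ (Set.range fun n : ℕ × ℕ × ℕ => k ^ n.1 * d ^ n.2.1 * p ^ n.2.2)

lemma monomial_mem_orderedSpan (p d k : A) (i j l : ℕ) :
    k ^ i * (d ^ j * p ^ l) ∈ orderedSpan p d k :=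
  Submodule.subset_span ⟨(i, j, l), mul_assoc _ _ _⟩

lemma mul_mem_orderedSpan_of_monomial {a : A}
    (h : ∀ i j l : ℕ, a * (k ^ i * (d ^ j * p ^ l)) ∈ orderedSpan p d k) {s : A}
    (hs : s ∈ orderedSpan p d k) : a * s ∈ orderedSpan p d k := by
  induction hs using Submodule.span_induction with
  | mem x hx =>
    obtain ⟨⟨i, j, l⟩, rfl⟩ := hx
    simpa only [mul_assoc] using h i j l
  | zero => simp
  | add x y _ _ hx hy => rw [mul_add]; exact add_mem hx hy
  | smul r x _ hx => rw [mul_smul_comm]; exact Submodule.smul_mem _ r hx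

lemma k_mul_mem_orderedSpan {s : A} (hs : s ∈ orderedSpan p d k) :
    k * s ∈ orderedSpan p d k := by
  refine mul_mem_orderedSpan_of_monomial (fun i j l => ?_) hs
  rw [← mul_assoc, ← pow_succ']
  exact monomial_mem_orderedSpan p d k (i + 1) j l

lemma d_mul_mem_orderedSpan (hdk : d * k = k * d + k) {s : A}
    (hs : s ∈ orderedSpan p d k) : d * s ∈ orderedSpan p d k := by
  refine mul_mem_orderedSpan_of_monomial (fun i j l => ?_) hs
  induction i with
  | zero =>
    have := monomial_mem_orderedSpan p d k 0 (j + 1) l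
    rw [pow_succ', mul_assoc] at this
    simpa using this
  | succ i ih =>
    have h : d * (k ^ (i + 1) * (d ^ j * p ^ l)) =
        k * (d * (k ^ i * (d ^ j * p ^ l))) + k * (k ^ i * (d ^ j * p ^ l)) := by
      rw [pow_succ', mul_assoc k, ← mul_assoc d, hdk, add_mul, mul_assoc k d]
    rw [h]
    exact add_mem (k_mul_mem_orderedSpan ih)
      (k_mul_mem_orderedSpan (monomial_mem_orderedSpan p d k i j l))

lemma p_mul_mem_orderedSpan (hdk : d * k = k * d + k) (hpd : p * d = d * p + p)
    (hpk : p * k = k * p + (2 : ℝ) • d) {s : A}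
    (hs : s ∈ orderedSpan p d k) : p * s ∈ orderedSpan p d k := by
  refine mul_mem_orderedSpan_of_monomial (fun i j l => ?_) hs
  induction i with
  | zero =>
    rw [pow_zero, one_mul]
    induction j with
    | zero => simpa [pow_succ'] using monomial_mem_orderedSpan p d k 0 0 (l + 1)
    | succ j ih =>
      have h : p * (d ^ (j + 1) * p ^ l) = d * (p * (d ^ j * p ^ l)) + p * (d ^ j * p ^ l) := by
        rw [pow_succ', mul_assoc d, ← mul_assoc p, hpd, add_mul, mul_assoc d p]
      rw [h]
      exact add_mem (d_mul_mem_orderedSpan hdk ih) ih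
  | succ i ih =>
    have h : p * (k ^ (i + 1) * (d ^ j * p ^ l)) =
        k * (p * (k ^ i * (d ^ j * p ^ l))) + (2 : ℝ) • (d * (k ^ i * (d ^ j * p ^ l))) := by
      rw [pow_succ', mul_assoc k, ← mul_assoc p, hpk, add_mul, mul_assoc k p, smul_mul_assoc]
    rw [h]
    exact add_mem (k_mul_mem_orderedSpan ih) (Submodule.smul_mem _ _
      (d_mul_mem_orderedSpan hdk (monomial_mem_orderedSpan p d k i j l)))

/-- The easy half of the Poincaré–Birkhoff–Witt theorem for `sl(2,ℝ)`: ordered monomials span. -/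
lemma orderedSpan_eq_top (hdk : d * k = k * d + k) (hpd : p * d = d * p + p)
    (hpk : p * k = k * p + (2 : ℝ) • d) (hgen : Algebra.adjoin ℝ {p, d, k} = ⊤) :
    orderedSpan p d k = ⊤ := by
  have key : ∀ a : A, ∀ s ∈ orderedSpan p d k, a * s ∈ orderedSpan p d k := by
    intro a
    have ha : a ∈ Algebra.adjoin ℝ {p, d, k} := hgen ▸ Algebra.mem_top
    induction ha using Algebra.adjoin_induction with
    | mem x hx =>
      rcases hx with rfl | rfl | rfl <;> intro s hs
      · exact p_mul_mem_orderedSpan hdk hpd hpk hs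
      · exact d_mul_mem_orderedSpan hdk hs
      · exact k_mul_mem_orderedSpan hs
    | algebraMap r =>
      intro s hs
      rw [← Algebra.smul_def]
      exact Submodule.smul_mem _ r hs
    | add x y _ _ hx hy =>
      intro s hs
      rw [add_mul]
      exact add_mem (hx s hs) (hy s hs)
    | mul x y _ _ hx hy =>
      intro s hs
      rw [mul_assoc]
      exact hx _ (hy s hs)
  refine Submodule.eq_top_iff'.2 fun a => ?_
  simpa using key a 1 (by simpa using monomial_mem_orderedSpan p d k 0 0 0)

end Sl2Relations

section Operators

lemma P_apply (q : MvPolynomial (Fin 2) ℝ) : P q = pderiv 1 q := rfl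

lemma D_apply (q : MvPolynomial (Fin 2) ℝ) :
    D q = X 0 * pderiv 0 q + X 1 * pderiv 1 q := rfl

lemma K_apply (q : MvPolynomial (Fin 2) ℝ) :
    K q = 2 * X 0 * X 1 * pderiv 0 q + X 1 ^ 2 * pderiv 1 q + X 0 * q := rfl

lemma pderiv_zero_pderiv_one (q : MvPolynomial (Fin 2) ℝ) :
    pderiv 0 (pderiv 1 q) = pderiv 1 (pderiv 0 q) := by
  have h : ⁅pderiv (R := ℝ) (0 : Fin 2), pderiv (R := ℝ) (1 : Fin 2)⁆ = 0 := by
    ext i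
    fin_cases i <;> simp [Derivation.commutator_apply, pderiv_X]
  have := congrArg (fun f => f q) h
  simpa [Derivation.commutator_apply, sub_eq_zero] using this

lemma pderiv_two (i : Fin 2) : pderiv i (2 : MvPolynomial (Fin 2) ℝ) = 0 :=
  (pderiv i).map_natCast 2

lemma D_mul_K : D * K = K * D + K := by
  refine LinearMap.ext fun q => ?_
  simp [D_apply, K_apply, Derivation.leibniz, pderiv_X, pderiv_two, pderiv_zero_pderiv_one]
  ring

lemma P_mul_D : P * D = D * P + P := by
  refine LinearMap.ext fun q => ?_
  simp [D_apply, P_apply, Derivation.leibniz, pderiv_X, pderiv_zero_pderiv_one]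
  ring

lemma P_mul_K : P * K = K * P + (2 : ℝ) • D := by
  refine LinearMap.ext fun q => ?_
  simp [D_apply, P_apply, K_apply, Derivation.leibniz, pderiv_X, pderiv_two, pderiv_zero_pderiv_one,
    two_smul]
  ring

lemma P_pow_apply (a b l : ℕ) :
    (P ^ l) (X 0 ^ a * X 1 ^ b) = (b.descFactorial l : ℝ) • (X 0 ^ a * X 1 ^ (b - l)) := by
  induction l with
  | zero => simp
  | succ l ih =>
    rw [pow_succ', Module.End.mul_apply, ih, map_smul, P_apply, Nat.descFactorial_succ]
    simp [Derivation.leibniz, Derivation.leibniz_pow, pderiv_X, smul_eq_C_mul, Nat.sub_sub]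
    ring

lemma D_pow_apply (a j : ℕ) : (D ^ j) (X 0 ^ a) = (a : ℝ) ^ j • X 0 ^ a := by
  induction j with
  | zero => simp
  | succ j ih =>
    rw [pow_succ', Module.End.mul_apply, ih, map_smul, D_apply]
    cases a <;>
    simp [Derivation.leibniz_pow, pderiv_X, smul_eq_C_mul]
    ring

lemma exists_K_pow_apply (a i : ℕ) : ∃ r, (K ^ i) (X 0 ^ a) =
    ((2 * a).ascFactorial i : ℝ) • (X 0 ^ a * X 1 ^ i) + X 0 ^ (a + 1) * r := by
  induction i with
  | zero => exact ⟨0, by simp⟩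
  | succ i ih =>
    obtain ⟨r, hr⟩ := ih
    refine ⟨((2 * a).ascFactorial i : ℝ) • X 1 ^ i + 2 * ((a + 1 : ℕ) : MvPolynomial _ ℝ) * X 1 * r
      + K r, ?_⟩
    rw [pow_succ', Module.End.mul_apply, hr, map_add, map_smul, K_apply, K_apply, K_apply,
      Nat.ascFactorial_succ]
    have hC : (C 2 : MvPolynomial (Fin 2) ℝ) = 2 := map_ofNat C 2
    cases a <;> cases i <;>
    simp [Derivation.leibniz, Derivation.leibniz_pow, pderiv_X, smul_eq_C_mul, hC] <;>
    ring

lemma coeff_K_pow_apply (a i n : ℕ) :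
    coeff (Finsupp.single 0 a + Finsupp.single 1 n) ((K ^ i) (X 0 ^ a)) =
      if i = n then ((2 * a).ascFactorial i : ℝ) else 0 := by
  obtain ⟨r, hr⟩ := exists_K_pow_apply a i
  have h1 : (X 0 ^ a * X 1 ^ i : MvPolynomial (Fin 2) ℝ) =
      monomial (Finsupp.single 0 a + Finsupp.single 1 i) 1 := by
    rw [X_pow_eq_monomial, X_pow_eq_monomial, monomial_mul, one_mul]
  have h2 : Finsupp.single (0 : Fin 2) a + Finsupp.single 1 i =
      Finsupp.single 0 a + Finsupp.single 1 n ↔ i = n := by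
    rw [add_right_inj, (Finsupp.single_injective _).eq_iff]
  have h3 : ¬ Finsupp.single (0 : Fin 2) (a + 1) ≤ Finsupp.single 0 a + Finsupp.single 1 n := by
    intro h
    simpa using h 0
  rw [hr, h1, X_pow_eq_monomial, coeff_add, coeff_smul, coeff_monomial_mul', if_neg h3,
    coeff_monomial]
  simp [h2]

lemma coeff_orderedMonomial_apply {a b n i j l : ℕ} (hl : b ≤ l) :
    coeff (Finsupp.single 0 a + Finsupp.single 1 n)
      ((K ^ i * D ^ j * P ^ l) (X 0 ^ a * X 1 ^ b)) =
      if i = n ∧ l = b then (b.factorial * (2 * a).ascFactorial n : ℝ) * a ^ j else 0 := by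
  rw [Module.End.mul_apply, Module.End.mul_apply, P_pow_apply]
  rcases hl.eq_or_lt with rfl | hl
  · rw [Nat.sub_self, pow_zero, mul_one, map_smul, D_pow_apply, map_smul, map_smul, coeff_smul,
      coeff_smul, coeff_K_pow_apply, Nat.descFactorial_self]
    by_cases h : i = n
    · simp [h]; ring
    · simp [h]
  · simp [Nat.descFactorial_of_lt hl, hl.ne']

lemma linearIndependent_orderedMonomials :
    LinearIndependent ℝ fun n : ℕ × ℕ × ℕ => K ^ n.1 * D ^ n.2.1 * P ^ n.2.2 := by
  rw [linearIndependent_iff]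
  intro c hc
  suffices h : ∀ l i j, c (i, j, l) = 0 from Finsupp.ext fun n => h n.2.2 n.1 n.2.1
  intro l
  induction l using Nat.strong_induction_on with
  | _ b ih =>
  intro n j
  let q : Polynomial ℝ :=
    ∑ m ∈ c.support with m.1 = n ∧ m.2.2 = b, Polynomial.monomial m.2.1 (c m)
  have hq : q = 0 := by
    refine Polynomial.eq_zero_of_infinite_isRoot q (Set.Infinite.mono ?_
      (Set.infinite_range_of_injective fun x y (h : ((x + 1 : ℕ) : ℝ) = ((y + 1 : ℕ) : ℝ)) => by
        simpa using h))
    rintro _ ⟨a, rfl⟩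
    have h0 : (b.factorial * (2 * (a + 1)).ascFactorial n : ℝ) ≠ 0 := by
      exact_mod_cast mul_ne_zero b.factorial_ne_zero (Nat.ascFactorial_pos _ _).ne'
    refine (mul_eq_zero.1 ?_).resolve_left h0
    have h := congrArg (fun T : E => coeff (Finsupp.single 0 (a + 1) + Finsupp.single 1 n)
      (T (X 0 ^ (a + 1) * X 1 ^ b))) hc
    simp only [Finsupp.linearCombination_apply, Finsupp.sum, LinearMap.sum_apply, coeff_sum,
      LinearMap.smul_apply, coeff_smul, LinearMap.zero_apply, coeff_zero] at h
    rw [← h, Polynomial.eval_finsetSum, Finset.mul_sum, Finset.sum_filter]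
    refine Finset.sum_congr rfl fun m hm => ?_
    have hl : b ≤ m.2.2 := by
      by_contra! hlt
      exact Finsupp.mem_support_iff.1 hm (ih _ hlt m.1 m.2.1)
    rw [coeff_orderedMonomial_apply hl, Polynomial.eval_monomial]
    split_ifs
    · rw [smul_eq_mul]; ring
    · simp
  have hcoeff : q.coeff j = c (n, j, b) := by
    rw [Polynomial.finsetSum_coeff, Finset.sum_eq_single (n, j, b)]
    · simp
    · rintro ⟨i', j', l'⟩ hm hne
      obtain ⟨-, rfl, rfl⟩ := Finset.mem_filter.1 hm
      rw [Polynomial.coeff_monomial, if_neg]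
      rintro rfl
      exact hne rfl
    · intro hm
      simpa using hm
  rw [← hcoeff, hq, Polynomial.coeff_zero]

end Operators

section Isomorphism

attribute [local instance] LieRing.ofAssociativeRing

open LieAlgebra.SpecialLinear

lemma sl_two_apply_one_one (A : sl (Fin 2) ℝ) : A.val 1 1 = -A.val 0 0 := by
  have h : Matrix.trace A.val = 0 := A.2
  rw [Matrix.trace_fin_two] at h
  linarith

/-- The representation of `sl(2,ℝ)` by the operators `P`, `D`, `K`. -/
noncomputable def slRep : sl (Fin 2) ℝ →ₗ⁅ℝ⁆ E where
  toFun A := A.val 0 1 • K - A.val 1 0 • P + (2 * A.val 0 0) • D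
  map_add' A B := by simp; module
  map_smul' r A := by simp; module
  map_lie' {A B} := by
    simp only [LieRing.of_associative_ring_bracket, sl_bracket, Matrix.sub_apply,
      Matrix.mul_apply, Fin.sum_univ_two, sl_two_apply_one_one, add_mul, sub_mul, mul_add, mul_sub,
      smul_mul_smul_comm, D_mul_K, P_mul_D, P_mul_K]
    module

lemma adjoin_range_ι {L : Type*} [LieRing L] [LieAlgebra ℝ L] :
    Algebra.adjoin ℝ (Set.range (UniversalEnvelopingAlgebra.ι ℝ (L := L))) = ⊤ := by
  set S := Algebra.adjoin ℝ (Set.range (UniversalEnvelopingAlgebra.ι ℝ (L := L)))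
  have hmem : ∀ x : L, UniversalEnvelopingAlgebra.ι ℝ x ∈ S := fun x =>
    Algebra.subset_adjoin ⟨x, rfl⟩
  let f : L →ₗ⁅ℝ⁆ S :=
    { toFun := fun x => ⟨UniversalEnvelopingAlgebra.ι ℝ x, hmem x⟩
      map_add' := fun x y => Subtype.ext (map_add _ x y)
      map_smul' := fun r x => Subtype.ext (map_smul _ r x)
      map_lie' := fun {x y} => Subtype.ext (LieHom.map_lie _ x y) }
  have h : S.val.comp (UniversalEnvelopingAlgebra.lift ℝ f) = AlgHom.id ℝ _ := by
    apply UniversalEnvelopingAlgebra.hom_ext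
    ext x
    exact congrArg Subtype.val (UniversalEnvelopingAlgebra.lift_ι_apply ℝ f x)
  refine Algebra.eq_top_iff.2 fun u => ?_
  rw [← AlgHom.id_apply (R := ℝ) u, ← h]
  exact (UniversalEnvelopingAlgebra.lift ℝ f u).2

lemma exists_generators_enveloping_sl : ∃ p d k : UniversalEnvelopingAlgebra ℝ (sl (Fin 2) ℝ),
    Algebra.adjoin ℝ {p, d, k} = ⊤ ∧
    d * k = k * d + k ∧ p * d = d * p + p ∧ p * k = k * p + (2 : ℝ) • d ∧
    UniversalEnvelopingAlgebra.lift ℝ slRep p = P ∧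
    UniversalEnvelopingAlgebra.lift ℝ slRep d = D ∧
    UniversalEnvelopingAlgebra.lift ℝ slRep k = K := by
  let e : sl (Fin 2) ℝ := single 0 1 (by decide) 1
  let f : sl (Fin 2) ℝ := single 1 0 (by decide) (-1)
  let h : sl (Fin 2) ℝ := singleSubSingle 0 1 (1 / 2)
  have hhe : ⁅h, e⁆ = e := by
    refine Subtype.ext ?_
    rw [sl_bracket]
    ext i j
    fin_cases i <;> fin_cases j <;> simp [h, e, Matrix.mul_apply, Matrix.single]
    norm_num
  have hfh : ⁅f, h⁆ = f := by
    refine Subtype.ext ?_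
    rw [sl_bracket]
    ext i j
    fin_cases i <;> fin_cases j <;> simp [h, f, Matrix.mul_apply, Matrix.single]
    norm_num
  have hfe : ⁅f, e⁆ = (2 : ℝ) • h := by
    refine Subtype.ext ?_
    rw [sl_bracket]
    ext i j
    fin_cases i <;> fin_cases j <;> simp [h, e, f, Matrix.mul_apply, Matrix.single]
  let ι := UniversalEnvelopingAlgebra.ι ℝ (L := sl (Fin 2) ℝ)
  have comm : ∀ x y z, ⁅x, y⁆ = z → ι x * ι y = ι y * ι x + ι z := by
    rintro x y _ rfl
    rw [LieHom.map_lie, LieRing.of_associative_ring_bracket]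
    abel
  refine ⟨ι f, ι h, ι e, ?_, comm _ _ _ hhe, comm _ _ _ hfh, ?_, ?_, ?_, ?_⟩
  · refine top_unique (adjoin_range_ι.ge.trans (Algebra.adjoin_le ?_))
    rintro _ ⟨A, rfl⟩
    have hA : A = A.val 0 1 • e - A.val 1 0 • f + (2 * A.val 0 0) • h := by
      have := sl_two_apply_one_one A
      ext i j
      fin_cases i <;> fin_cases j <;> simp [h, e, f, Matrix.single, this] <;> ring
    rw [hA, map_add, map_sub, map_smul, map_smul, map_smul]
    refine add_mem (sub_mem ?_ ?_) ?_ <;>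
      exact Subalgebra.smul_mem _ (Algebra.subset_adjoin (by simp [ι])) _
  · rw [comm _ _ _ hfe, map_smul]
  · rw [UniversalEnvelopingAlgebra.lift_ι_apply]
    simp [slRep, f]
    module
  · rw [UniversalEnvelopingAlgebra.lift_ι_apply]
    simp [slRep, h]
  · rw [UniversalEnvelopingAlgebra.lift_ι_apply]
    simp [slRep, e]

end Isomorphism

/-- The associative unital subalgebra of `E` generated by `P`, `D`, `K` is
isomorphic as an `ℝ`-algebra to the universal enveloping algebra of `sl(2,ℝ)`. -/
theorem stmt_7 :
    Nonempty ((Algebra.adjoin ℝ {P, D, K}) ≃ₐ[ℝ]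
      UniversalEnvelopingAlgebra ℝ (LieAlgebra.SpecialLinear.sl (Fin 2) ℝ)) := by
  obtain ⟨p, d, k, hgen, hdk, hpd, hpk, hP, hD, hK⟩ := exists_generators_enveloping_sl
  set φ := UniversalEnvelopingAlgebra.lift ℝ slRep
  have hrange : φ.range = Algebra.adjoin ℝ {P, D, K} := by
    rw [← Algebra.map_top, ← hgen, AlgHom.map_adjoin, Set.image_insert_eq, Set.image_pair, hP, hD,
      hK]
  have hinj : Function.Injective φ := by
    refine (injective_iff_map_eq_zero φ).2 fun u hu => ?_
    have hmem : u ∈ orderedSpan p d k := by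
      rw [orderedSpan_eq_top hdk hpd hpk hgen]
      trivial
    obtain ⟨c, rfl⟩ := (Finsupp.mem_span_range_iff_exists_finsupp).1 hmem
    suffices hc : c = 0 by simp [hc]
    refine linearIndependent_iff.1 linearIndependent_orderedMonomials c ?_
    rw [← hu, Finsupp.linearCombination_apply, map_finsuppSum]
    simp only [map_smul, map_mul, map_pow, hP, hD, hK]
  exact ⟨((AlgEquiv.ofInjective φ hinj).trans (Subalgebra.equivOfEq _ _ hrange)).symm⟩
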